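/- arXiv:2602.03508 — 6 statements merged into one kernel-verified Lean document; each statement's English description precedes it below -/
import Mathlib

section
/- Let d ≥ 1 and n ≥ 1, let γ̄ = (γ₁,…,γₙ) be directional functions on S^{d-1}, and let A = [a_ij] ∈ ℝ^{n×n} be a nonnegative matrix satisfying, for every i ∈ {1,…,n}, a_ii · min_{x∈S^{d-1}} γ_i(x) > Σ_{j≠i} a_ij · max_{x∈S^{d-1}} γ_j(x). Then for every matrix X ∈ S(n,d,γ̄) and every i ∈ {1,…,n}, the i-th row of the matrix product AX is nonzero. -/
open Finset Filter Topology Matrix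

noncomputable def euclNorm {d : ℕ} (x : Fin d → ℝ) : ℝ := Real.sqrt (∑ j, x j ^ 2)

def unitSphere (d : ℕ) : Set (Fin d → ℝ) := {x | euclNorm x = 1}

/-- A directional function on `S^{d-1}`: continuous and bounded above and below
by positive constants on the unit sphere. -/
def IsDirectional {d : ℕ} (γ : (Fin d → ℝ) → ℝ) : Prop :=
  ContinuousOn γ (unitSphere d) ∧
    ∃ c C : ℝ, 0 < c ∧ ∀ x ∈ unitSphere d, c ≤ γ x ∧ γ x ≤ C

/-- The star boundary `S^{d-1}_γ = {γ(x) x : x ∈ S^{d-1}}`. -/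
def starBoundary {d : ℕ} (γ : (Fin d → ℝ) → ℝ) : Set (Fin d → ℝ) :=
  {y | ∃ x ∈ unitSphere d, y = γ x • x}

/-- `S(n,d,γ̄)`: matrices whose `i`-th row lies on the star boundary of `γ_i`. -/
def Sset (n d : ℕ) (γbar : Fin n → (Fin d → ℝ) → ℝ) : Set (Matrix (Fin n) (Fin d) ℝ) :=
  {X | ∀ i, X i ∈ starBoundary (γbar i)}

/-- Radial projection `P_γ(y) = γ(y/‖y‖₂) · y/‖y‖₂`. -/
noncomputable def radialProj {d : ℕ} (γ : (Fin d → ℝ) → ℝ) (y : Fin d → ℝ) : Fin d → ℝ :=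
  γ ((euclNorm y)⁻¹ • y) • ((euclNorm y)⁻¹ • y)

/-- Row-wise radial projection. -/
noncomputable def rowProj {n d : ℕ} (γbar : Fin n → (Fin d → ℝ) → ℝ)
    (B : Matrix (Fin n) (Fin d) ℝ) : Matrix (Fin n) (Fin d) ℝ :=
  Matrix.of fun i => radialProj (γbar i) (B i)

/-- Assumption 2: each `γ_i` is directional, `A` is a nonnegative weight matrix of a strongly
connected digraph, and the diagonal-dominance condition
`a_ii · min γ_i > Σ_{j≠i} a_ij · max γ_j` holds. -/
def Assumption2 {n d : ℕ} (A : Matrix (Fin n) (Fin n) ℝ)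
    (γbar : Fin n → (Fin d → ℝ) → ℝ) : Prop :=
  (∀ i, IsDirectional (γbar i)) ∧
  (∃ E : Fin n → Fin n → Prop,
    (∀ i j, E i j → 0 < A i j) ∧ (∀ i j, ¬ E i j → A i j = 0) ∧
    (∀ i j, Relation.ReflTransGen E i j)) ∧
  (∀ i, (∑ j ∈ Finset.univ.erase i, A i j * sSup (γbar j '' unitSphere d)) <
      A i i * sInf (γbar i '' unitSphere d))

/-- The trajectory of the algorithm `X(t+1) = P_γ̄(A X(t))`, indexed by `k = t - t₀`. -/
noncomputable def traj {n d : ℕ} (A : Matrix (Fin n) (Fin n) ℝ)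
    (γbar : Fin n → (Fin d → ℝ) → ℝ) (X₀ : Matrix (Fin n) (Fin d) ℝ) :
    ℕ → Matrix (Fin n) (Fin d) ℝ
  | 0 => X₀
  | k + 1 => rowProj γbar (A * traj A γbar X₀ k)

/-- `D_γ̄(B)`: diagonal matrix with entries `γ_i([B]_i/‖[B]_i‖₂)/‖[B]_i‖₂`. -/
noncomputable def Dmat {n d : ℕ} (γbar : Fin n → (Fin d → ℝ) → ℝ)
    (B : Matrix (Fin n) (Fin d) ℝ) : Matrix (Fin n) (Fin n) ℝ :=
  Matrix.diagonal fun i => γbar i ((euclNorm (B i))⁻¹ • B i) / euclNorm (B i)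

/-- The product matrices `Ã(k,t₀,X₀) = D_γ̄(A X(t₀+k−1))A ⋯ D_γ̄(A X(t₀))A`. -/
noncomputable def Atilde {n d : ℕ} (A : Matrix (Fin n) (Fin n) ℝ)
    (γbar : Fin n → (Fin d → ℝ) → ℝ) (X₀ : Matrix (Fin n) (Fin d) ℝ) :
    ℕ → Matrix (Fin n) (Fin n) ℝ
  | 0 => 1
  | k + 1 => Dmat γbar (A * traj A γbar X₀ k) * A * Atilde A γbar X₀ k

/-- `v` is the strictly positive unit vector to which all Euclidean-normalized rows of
`Ã(k,t₀,X₀)` converge. -/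
def IsLimitVec {n d : ℕ} (A : Matrix (Fin n) (Fin n) ℝ)
    (γbar : Fin n → (Fin d → ℝ) → ℝ) (X₀ : Matrix (Fin n) (Fin d) ℝ)
    (v : Fin n → ℝ) : Prop :=
  euclNorm v = 1 ∧ (∀ i, 0 < v i) ∧
    ∀ i, Tendsto (fun k => (euclNorm (Atilde A γbar X₀ k i))⁻¹ • Atilde A γbar X₀ k i)
      atTop (𝓝 v)

/-- Asymptotic consensus of directions. -/
def ConsensusDir {n d : ℕ} (X : ℕ → Matrix (Fin n) (Fin d) ℝ) : Prop :=
  ∀ i j, Tendsto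
    (fun t => euclNorm ((euclNorm (X t i))⁻¹ • X t i - (euclNorm (X t j))⁻¹ • X t j))
    atTop (𝓝 0)

/-- Asymptotic consensus of directions with point-wise convergence to a unit vector. -/
def ConsensusPW {n d : ℕ} (X : ℕ → Matrix (Fin n) (Fin d) ℝ) : Prop :=
  ∃ u : Fin d → ℝ, euclNorm u = 1 ∧
    ∀ i, Tendsto (fun t => (euclNorm (X t i))⁻¹ • X t i) atTop (𝓝 u)

theorem sum_sq_eq_one_of_mem_unitSphere {d : ℕ} {x : Fin d → ℝ} (hx : x ∈ unitSphere d) :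
    ∑ k, x k ^ 2 = 1 :=
  Real.sqrt_eq_one.mp hx

theorem neg_one_le_dotProduct_of_mem_unitSphere {d : ℕ} {x y : Fin d → ℝ}
    (hx : x ∈ unitSphere d) (hy : y ∈ unitSphere d) : -1 ≤ x ⬝ᵥ y := by
  have h : 0 ≤ ∑ k, (x k + y k) ^ 2 := Finset.sum_nonneg fun k _ => sq_nonneg _
  have e : ∑ k, (x k + y k) ^ 2 = ∑ k, x k ^ 2 + 2 * (x ⬝ᵥ y) + ∑ k, y k ^ 2 := by
    simp only [dotProduct, Finset.mul_sum, ← Finset.sum_add_distrib]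
    exact Finset.sum_congr rfl fun k _ => by ring
  rw [e, sum_sq_eq_one_of_mem_unitSphere hx, sum_sq_eq_one_of_mem_unitSphere hy] at h
  linarith

theorem IsDirectional.pos {d : ℕ} {γ : (Fin d → ℝ) → ℝ} (h : IsDirectional γ)
    {x : Fin d → ℝ} (hx : x ∈ unitSphere d) : 0 < γ x := by
  obtain ⟨-, c, C, hc, hb⟩ := h
  exact hc.trans_le (hb x hx).1

theorem IsDirectional.le_sSup {d : ℕ} {γ : (Fin d → ℝ) → ℝ} (h : IsDirectional γ)
    {x : Fin d → ℝ} (hx : x ∈ unitSphere d) : γ x ≤ sSup (γ '' unitSphere d) := by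
  obtain ⟨-, c, C, -, hb⟩ := h
  exact le_csSup ⟨C, Set.forall_mem_image.mpr fun y hy => (hb y hy).2⟩
    (Set.mem_image_of_mem γ hx)

theorem IsDirectional.sInf_le {d : ℕ} {γ : (Fin d → ℝ) → ℝ} (h : IsDirectional γ)
    {x : Fin d → ℝ} (hx : x ∈ unitSphere d) : sInf (γ '' unitSphere d) ≤ γ x := by
  obtain ⟨-, c, C, -, hb⟩ := h
  exact csInf_le ⟨c, Set.forall_mem_image.mpr fun y hy => (hb y hy).1⟩
    (Set.mem_image_of_mem γ hx)

theorem stmt0 {n d : ℕ} (hd : 1 ≤ d) (hn : 1 ≤ n)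
    (γbar : Fin n → (Fin d → ℝ) → ℝ) (hγ : ∀ i, IsDirectional (γbar i))
    (A : Matrix (Fin n) (Fin n) ℝ) (hA : ∀ i j, 0 ≤ A i j)
    (hdom : ∀ i, (∑ j ∈ Finset.univ.erase i, A i j * sSup (γbar j '' unitSphere d)) <
      A i i * sInf (γbar i '' unitSphere d))
    (X : Matrix (Fin n) (Fin d) ℝ) (hX : X ∈ Sset n d γbar) (i : Fin n) :
    (A * X) i ≠ (0 : Fin d → ℝ) := by
  intro h0
  choose x hx hXx using hX
  have hrow : ∑ j, A i j * (γbar j (x j) * (x j ⬝ᵥ x i)) = 0 := by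
    have h1 : (A * X) i ⬝ᵥ x i = 0 := by rw [h0, zero_dotProduct]
    have h2 : (A * X) i = ∑ j, A i j • X j := by
      ext k
      simp [Matrix.mul_apply]
    rw [h2, sum_dotProduct] at h1
    rw [← h1]
    refine Finset.sum_congr rfl fun j _ => ?_
    rw [hXx j, smul_dotProduct, smul_dotProduct, smul_eq_mul, smul_eq_mul]
  have hself : x i ⬝ᵥ x i = 1 := by
    rw [← sum_sq_eq_one_of_mem_unitSphere (hx i)]
    exact Finset.sum_congr rfl fun k _ => (sq (x i k)).symm
  rw [← Finset.add_sum_erase _ _ (Finset.mem_univ i), hself, mul_one] at hrow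
  have hdiag := mul_le_mul_of_nonneg_left ((hγ i).sInf_le (hx i)) (hA i i)
  have hoff : -∑ j ∈ Finset.univ.erase i, A i j * sSup (γbar j '' unitSphere d) ≤
      ∑ j ∈ Finset.univ.erase i, A i j * (γbar j (x j) * (x j ⬝ᵥ x i)) := by
    rw [← Finset.sum_neg_distrib]
    refine Finset.sum_le_sum fun j _ => ?_
    rw [← mul_neg]
    refine mul_le_mul_of_nonneg_left ?_ (hA i j)
    have h1 := mul_le_mul_of_nonneg_left
      (neg_one_le_dotProduct_of_mem_unitSphere (hx j) (hx i)) ((hγ j).pos (hx j)).le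
    linarith [(hγ j).le_sSup (hx j)]
  linarith [hdom i]
end

section
/- Suppose the sequence of matrices A(t), t ≥ 0, satisfies Assumption 1 with constants 0 < σ_l ≤ σ_u, and let Ã(k,t₀) = A(t₀+k−1)A(t₀+k−2)⋯A(t₀). Then for every p ∈ {1,2,3,…} ∪ {∞} there exist positive constants δ₁ and δ₂, depending only on n, σ_l and σ_u (and not on k or t₀), such that δ₁ ≤ ‖[Ã(k,t₀)]_i‖_p / ‖[Ã(k,t₀)]_j‖_p ≤ δ₂ for all t₀ ≥ 0, all k ≥ 1 and all i, j ∈ {1,…,n}, where [M]_i denotes the i-th row of M and ‖·‖_p is the vector p-norm. For p = 1 one may take δ₁ = σ_lⁿ/(σ_uⁿ nⁿ) and δ₂ = σ_uⁿ nⁿ/σ_lⁿ. -/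
open Finset Filter Topology Matrix

/-- Assumption 1: every `A(t)` is a nonnegative weight matrix for a fixed strongly connected
digraph containing all self-loops, with all positive entries in `[σl, σu]`. -/
def Assumption1 {n : ℕ} (Atv : ℕ → Matrix (Fin n) (Fin n) ℝ) (σl σu : ℝ) : Prop :=
  0 < σl ∧ σl ≤ σu ∧
    ∃ E : Fin n → Fin n → Prop,
      (∀ i, E i i) ∧ (∀ i j, Relation.ReflTransGen E i j) ∧
      (∀ t i j, (E i j → σl ≤ Atv t i j ∧ Atv t i j ≤ σu) ∧ (¬ E i j → Atv t i j = 0))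

/-- `Ã(k,t₀) = A(t₀+k−1) A(t₀+k−2) ⋯ A(t₀)`. -/
def prodA {n : ℕ} (Atv : ℕ → Matrix (Fin n) (Fin n) ℝ) (t₀ : ℕ) :
    ℕ → Matrix (Fin n) (Fin n) ℝ
  | 0 => 1
  | k + 1 => Atv (t₀ + k) * prodA Atv t₀ k

/-- The vector `p`-norm, for `p ∈ {1,2,…} ∪ {∞}`. -/
noncomputable def pnorm {m : ℕ} (p : ℕ∞) (x : Fin m → ℝ) : ℝ :=
  if p = ⊤ then ⨆ j, |x j|
  else (∑ j, |x j| ^ (p.toNat : ℝ)) ^ (p.toNat : ℝ)⁻¹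

/-- In a finite digraph in which every vertex is reachable from every other one, a nonempty proper
set of vertices has an edge entering it. -/
theorem exists_rel_of_not_mem_of_mem {α : Type*} {E : α → α → Prop} {S : Set α} {a b : α}
    (h : Relation.ReflTransGen E a b) (ha : a ∉ S) (hb : b ∈ S) :
    ∃ x y, E x y ∧ x ∉ S ∧ y ∈ S := by
  induction h with
  | refl => exact absurd hb ha
  | @tail c d _ hcd ih =>
    by_cases hc : c ∈ S
    · exact ih hc
    · exact ⟨c, d, hcd, hc, hb⟩

section Recursion

variable {n : ℕ} {σl σu : ℝ} {E : Fin n → Fin n → Prop} {B : ℕ → Matrix (Fin n) (Fin n) ℝ}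
  {r : ℕ → Fin n → ℝ}

theorem recursion_nonneg (hB : ∀ t i j, 0 ≤ B t i j)
    (hr : ∀ t i, r (t + 1) i = ∑ l, B t i l * r t l) (h0 : ∀ i, 0 ≤ r 0 i) (m : ℕ) (i : Fin n) :
    0 ≤ r m i := by
  induction m generalizing i with
  | zero => exact h0 i
  | succ m ih => rw [hr]; exact sum_nonneg fun l _ => mul_nonneg (hB _ _ _) (ih l)

theorem recursion_le (hB : ∀ t i j, 0 ≤ B t i j) (hBu : ∀ t i j, B t i j ≤ σu)
    (hr : ∀ t i, r (t + 1) i = ∑ l, B t i l * r t l) (h0 : ∀ i, 0 ≤ r 0 i) {M : ℝ}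
    (hM : ∀ i, r 0 i ≤ M) (m : ℕ) (i : Fin n) : r m i ≤ (n * σu) ^ m * M := by
  induction m generalizing i with
  | zero => simpa using hM i
  | succ m ih =>
    have hσu : 0 ≤ σu := (hB 0 i i).trans (hBu 0 i i)
    calc r (m + 1) i = ∑ l, B m i l * r m l := hr m i
      _ ≤ ∑ _l : Fin n, σu * ((n * σu) ^ m * M) := by
          gcongr with l
          · exact recursion_nonneg hB hr h0 m l
          · exact hBu m i l
          · exact ih l
      _ = (n * σu) ^ (m + 1) * M := by simp; ring

theorem mul_le_recursion_succ (hB : ∀ t i j, 0 ≤ B t i j) (hBl : ∀ t i j, E i j → σl ≤ B t i j)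
    (hr : ∀ t i, r (t + 1) i = ∑ l, B t i l * r t l) (h0 : ∀ i, 0 ≤ r 0 i) (m : ℕ)
    {i j : Fin n} (hij : E i j) : σl * r m j ≤ r (m + 1) i := by
  have hnn := recursion_nonneg hB hr h0 m
  rw [hr]
  exact (mul_le_mul_of_nonneg_right (hBl m i j hij) (hnn j)).trans
    (single_le_sum (f := fun l => B m i l * r m l)
      (fun l _ => mul_nonneg (hB _ _ _) (hnn l)) (mem_univ j))

theorem pow_mul_le_recursion (hσl : 0 < σl) (hE : ∀ i, E i i) (hB : ∀ t i j, 0 ≤ B t i j)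
    (hBl : ∀ t i j, E i j → σl ≤ B t i j)
    (hr : ∀ t i, r (t + 1) i = ∑ l, B t i l * r t l) (h0 : ∀ i, 0 ≤ r 0 i) (m : ℕ) (i : Fin n) :
    σl ^ m * r 0 i ≤ r m i := by
  induction m with
  | zero => simp
  | succ m ih =>
    calc σl ^ (m + 1) * r 0 i = σl * (σl ^ m * r 0 i) := by ring
      _ ≤ σl * r m i := by gcongr
      _ ≤ r (m + 1) i := mul_le_recursion_succ hB hBl hr h0 m (hE i)

/-- The number of coordinates that are at least `σl ^ m` times a given initial one grows by at
least one at every step until all coordinates are reached. -/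
theorem min_le_card_recursion (hσl : 0 < σl) (hE : ∀ i, E i i)
    (hconn : ∀ i j, Relation.ReflTransGen E i j) (hB : ∀ t i j, 0 ≤ B t i j)
    (hBl : ∀ t i j, E i j → σl ≤ B t i j)
    (hr : ∀ t i, r (t + 1) i = ∑ l, B t i l * r t l) (h0 : ∀ i, 0 ≤ r 0 i) (l : Fin n) (m : ℕ) :
    min n m ≤ #{i | σl ^ m * r 0 l ≤ r m i} := by
  induction m with
  | zero => simp
  | succ m ih =>
    have hstep : ∀ i j, E i j → σl ^ m * r 0 l ≤ r m j → σl ^ (m + 1) * r 0 l ≤ r (m + 1) i := by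
      intro i j hij hj
      calc σl ^ (m + 1) * r 0 l = σl * (σl ^ m * r 0 l) := by ring
        _ ≤ σl * r m j := by gcongr
        _ ≤ r (m + 1) i := mul_le_recursion_succ hB hBl hr h0 m hij
    have hsub : ({i | σl ^ m * r 0 l ≤ r m i} : Finset (Fin n)) ⊆
        ({i | σl ^ (m + 1) * r 0 l ≤ r (m + 1) i} : Finset (Fin n)) := by
      intro i hi
      simp only [mem_filter, mem_univ, true_and] at hi ⊢
      exact hstep i i (hE i) hi
    by_cases hall : ∀ i, σl ^ m * r 0 l ≤ r m i
    · have : ({i | σl ^ (m + 1) * r 0 l ≤ r (m + 1) i} : Finset (Fin n)) = univ := by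
        ext i; simpa using hstep i i (hE i) (hall i)
      simp [this]
    · obtain ⟨a, ha⟩ := not_forall.mp hall
      obtain ⟨x, y, hxy, hx, hy⟩ := exists_rel_of_not_mem_of_mem
        (S := {i | σl ^ m * r 0 l ≤ r m i}) (hconn a l) ha
        (pow_mul_le_recursion hσl hE hB hBl hr h0 m l)
      have hlt := card_lt_card (hsub.ssubset_of_not_subset fun h => hx <| by
        simpa using h (mem_filter.mpr ⟨mem_univ x, hstep x y hxy hy⟩))
      omega

theorem pow_mul_le_recursion_of_connected (hσl : 0 < σl) (hE : ∀ i, E i i)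
    (hconn : ∀ i j, Relation.ReflTransGen E i j) (hB : ∀ t i j, 0 ≤ B t i j)
    (hBl : ∀ t i j, E i j → σl ≤ B t i j)
    (hr : ∀ t i, r (t + 1) i = ∑ l, B t i l * r t l) (h0 : ∀ i, 0 ≤ r 0 i) (l i : Fin n) :
    σl ^ n * r 0 l ≤ r n i := by
  have h := min_le_card_recursion hσl hE hconn hB hBl hr h0 l n
  have huniv : ({i | σl ^ n * r 0 l ≤ r n i} : Finset (Fin n)) = univ :=
    eq_univ_of_card _ (le_antisymm (card_le_univ _) (by simpa using h))
  simpa using huniv.ge (mem_univ i)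

theorem recursion_le_mul (hσl : 0 < σl) (hσ : σl ≤ σu) (hE : ∀ i, E i i)
    (hconn : ∀ i j, Relation.ReflTransGen E i j) (hB : ∀ t i j, 0 ≤ B t i j)
    (hBu : ∀ t i j, B t i j ≤ σu) (hBl : ∀ t i j, E i j → σl ≤ B t i j)
    (hr : ∀ t i, r (t + 1) i = ∑ l, B t i l * r t l) (h0 : ∀ i, r 0 i = 1) (k : ℕ)
    (i j : Fin n) : r k i ≤ σu ^ n * (n : ℝ) ^ n / σl ^ n * r k j := by
  have h0' : ∀ i, 0 ≤ r 0 i := fun i => by rw [h0]; exact zero_le_one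
  have hσu : 0 < σu := hσl.trans_le hσ
  have hn : (1 : ℝ) ≤ n := by exact_mod_cast i.pos
  have hC : σu ^ n * (n : ℝ) ^ n / σl ^ n = (n * σu / σl) ^ n := by
    rw [div_pow, mul_pow]; ring
  rcases le_total n k with hk | hk
  · obtain ⟨s, rfl⟩ := Nat.exists_eq_add_of_le' hk
    have hnn := recursion_nonneg hB hr h0' s
    obtain ⟨l, -, hl⟩ := exists_max_image univ (r s) ⟨i, mem_univ i⟩
    have hr' : ∀ t i, r (s + (t + 1)) i = ∑ l, B (s + t) i l * r (s + t) l :=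
      fun t i => hr (s + t) i
    have hup := recursion_le (B := fun t => B (s + t)) (r := fun t => r (s + t))
      (fun t => hB _) (fun t => hBu _) hr' hnn (fun i => hl i (mem_univ i)) n i
    have hlow := pow_mul_le_recursion_of_connected (B := fun t => B (s + t))
      (r := fun t => r (s + t)) hσl hE hconn (fun t => hB _) (fun t => hBl _) hr' hnn l j
    calc r (s + n) i ≤ (n * σu) ^ n * r s l := hup
      _ = σu ^ n * (n : ℝ) ^ n / σl ^ n * (σl ^ n * r s l) := by rw [mul_pow]; field_simp
      _ ≤ _ := by gcongr; exact hlow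
  · have hup := recursion_le hB hBu hr h0' (fun i => (h0 i).le) k i
    have hlow := pow_mul_le_recursion hσl hE hB hBl hr h0' k j
    have hone : 1 ≤ n * σu / σl := by
      rw [one_le_div hσl]; nlinarith
    calc r k i ≤ (n * σu) ^ k * 1 := hup
      _ = (n * σu / σl) ^ k * (σl ^ k * r 0 j) := by rw [h0, div_pow]; field_simp
      _ ≤ (n * σu / σl) ^ n * r k j :=
          mul_le_mul (pow_le_pow_right₀ hone hk) hlow
            (mul_nonneg (pow_nonneg hσl.le k) (h0' j)) (by positivity)
      _ = _ := by rw [hC]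

end Recursion

section RowSums

variable {n : ℕ} {Atv : ℕ → Matrix (Fin n) (Fin n) ℝ} {σl σu : ℝ}

theorem Assumption1.nonneg (h : Assumption1 Atv σl σu) (t : ℕ) (i j : Fin n) : 0 ≤ Atv t i j := by
  obtain ⟨hσl, -, E, -, -, hA⟩ := h
  by_cases hij : E i j
  · exact hσl.le.trans ((hA t i j).1 hij).1
  · exact ((hA t i j).2 hij).ge

theorem Assumption1.le (h : Assumption1 Atv σl σu) (t : ℕ) (i j : Fin n) : Atv t i j ≤ σu := by
  obtain ⟨hσl, hσ, E, -, -, hA⟩ := h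
  by_cases hij : E i j
  · exact ((hA t i j).1 hij).2
  · exact ((hA t i j).2 hij).le.trans (hσl.le.trans hσ)

theorem prodA_nonneg (h : Assumption1 Atv σl σu) (t₀ k : ℕ) (i j : Fin n) :
    0 ≤ prodA Atv t₀ k i j := by
  induction k generalizing i with
  | zero => simp only [prodA, Matrix.one_apply]; split_ifs <;> norm_num
  | succ k ih =>
    rw [prodA, Matrix.mul_apply]
    exact sum_nonneg fun l _ => mul_nonneg (h.nonneg _ _ _) (ih l)

theorem sum_prodA_zero (t₀ : ℕ) (i : Fin n) : ∑ j, prodA Atv t₀ 0 i j = 1 := by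
  simp [prodA, Matrix.one_apply]

theorem sum_prodA_succ (t₀ k : ℕ) (i : Fin n) :
    ∑ j, prodA Atv t₀ (k + 1) i j = ∑ l, Atv (t₀ + k) i l * ∑ j, prodA Atv t₀ k l j := by
  simp only [prodA, Matrix.mul_apply, mul_sum]
  exact sum_comm

theorem sum_prodA_pos (h : Assumption1 Atv σl σu) (t₀ k : ℕ) (i : Fin n) :
    0 < ∑ j, prodA Atv t₀ k i j := by
  obtain ⟨hσl, -, E, hE, -, hA⟩ := id h
  have := pow_mul_le_recursion (B := fun t => Atv (t₀ + t))
    (r := fun k i => ∑ j, prodA Atv t₀ k i j) hσl hE (fun t => h.nonneg _)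
    (fun t i j hij => ((hA _ i j).1 hij).1) (sum_prodA_succ t₀)
    (fun i => (sum_prodA_zero t₀ i).symm ▸ zero_le_one) k i
  simp only [sum_prodA_zero, mul_one] at this
  exact (pow_pos hσl k).trans_le this

theorem sum_prodA_le_mul (h : Assumption1 Atv σl σu) (t₀ k : ℕ) (i j : Fin n) :
    ∑ l, prodA Atv t₀ k i l ≤ σu ^ n * (n : ℝ) ^ n / σl ^ n * ∑ l, prodA Atv t₀ k j l := by
  obtain ⟨hσl, hσ, E, hE, hconn, hA⟩ := id h
  exact recursion_le_mul (B := fun t => Atv (t₀ + t))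
    (r := fun k i => ∑ j, prodA Atv t₀ k i j) hσl hσ hE hconn (fun t => h.nonneg _)
    (fun t => h.le _) (fun t i j hij => ((hA _ i j).1 hij).1) (sum_prodA_succ t₀)
    (sum_prodA_zero t₀) k i j

end RowSums

section PNorm

variable {m : ℕ}

theorem pnorm_one_of_nonneg {x : Fin m → ℝ} (hx : ∀ j, 0 ≤ x j) : pnorm 1 x = ∑ j, x j := by
  have h : (1 : ℕ∞) ≠ ⊤ := by decide
  simp [pnorm, h, abs_of_nonneg (hx _)]

theorem abs_le_pnorm {p : ℕ∞} (hp : 1 ≤ p) (x : Fin m → ℝ) (j : Fin m) : |x j| ≤ pnorm p x := by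
  unfold pnorm
  split_ifs with h
  · exact le_ciSup (f := fun j => |x j|) (Set.finite_range _).bddAbove j
  · lift p to ℕ using h
    have hp : 1 ≤ p := by exact_mod_cast hp
    have hp0 : (0 : ℝ) < p := by exact_mod_cast hp
    simp only [ENat.toNat_natCast]
    rw [Real.le_rpow_inv_iff_of_pos (abs_nonneg _) (by positivity) hp0]
    exact single_le_sum (f := fun j => |x j| ^ (p : ℝ)) (fun _ _ => by positivity) (mem_univ j)

theorem sum_le_mul_pnorm {p : ℕ∞} (hp : 1 ≤ p) (x : Fin m → ℝ) :
    ∑ j, x j ≤ m * pnorm p x := by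
  calc ∑ j, x j ≤ ∑ _j : Fin m, pnorm p x :=
        sum_le_sum fun j _ => (le_abs_self _).trans (abs_le_pnorm hp x j)
    _ = m * pnorm p x := by simp

theorem pnorm_le_mul_sum {p : ℕ∞} (hp : 1 ≤ p) (hm : 1 ≤ m) {x : Fin m → ℝ}
    (hx : ∀ j, 0 ≤ x j) : pnorm p x ≤ m * ∑ j, x j := by
  have hm' : (1 : ℝ) ≤ m := by exact_mod_cast hm
  have hs : 0 ≤ ∑ j, x j := sum_nonneg fun j _ => hx j
  have hle : ∀ j, |x j| ≤ ∑ j, x j := fun j => by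
    rw [abs_of_nonneg (hx j)]; exact single_le_sum (fun j _ => hx j) (mem_univ j)
  unfold pnorm
  split_ifs with h
  · have : Nonempty (Fin m) := ⟨⟨0, hm⟩⟩
    exact (ciSup_le hle).trans (le_mul_of_one_le_left hs hm')
  · lift p to ℕ using h
    have hp : 1 ≤ p := by exact_mod_cast hp
    have hp1 : (1 : ℝ) ≤ p := by exact_mod_cast hp
    simp only [ENat.toNat_natCast]
    rw [Real.rpow_inv_le_iff_of_pos (by positivity) (by positivity) (by positivity)]
    calc ∑ j, |x j| ^ (p : ℝ) ≤ ∑ _j : Fin m, (∑ j, x j) ^ (p : ℝ) := by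
          gcongr with j; exact hle j
      _ = m * (∑ j, x j) ^ (p : ℝ) := by simp
      _ ≤ m ^ (p : ℝ) * (∑ j, x j) ^ (p : ℝ) := by
          gcongr; exact Real.self_le_rpow_of_one_le hm' hp1
      _ = (m * ∑ j, x j) ^ (p : ℝ) := (Real.mul_rpow (by positivity) hs).symm

end PNorm

theorem inv_le_div_and_div_le {a b C : ℝ} (ha : 0 < a) (hb : 0 < b) (hab : a ≤ C * b)
    (hba : b ≤ C * a) : C⁻¹ ≤ a / b ∧ a / b ≤ C := by
  have hC : 0 < C := pos_of_mul_pos_left (ha.trans_le hab) hb.le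
  refine ⟨?_, (div_le_iff₀ hb).mpr hab⟩
  rw [le_div_iff₀ hb, inv_mul_le_iff₀ hC]
  exact hba

theorem stmt1 (n : ℕ) (hn : 1 ≤ n) (σl σu : ℝ) (hσl : 0 < σl) (hσ : σl ≤ σu) :
    (∀ p : ℕ∞, 1 ≤ p →
      ∃ δ₁ δ₂ : ℝ, 0 < δ₁ ∧ 0 < δ₂ ∧
        ∀ Atv : ℕ → Matrix (Fin n) (Fin n) ℝ, Assumption1 Atv σl σu →
          ∀ t₀ k : ℕ, 1 ≤ k → ∀ i j : Fin n,
            δ₁ ≤ pnorm p (prodA Atv t₀ k i) / pnorm p (prodA Atv t₀ k j) ∧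
            pnorm p (prodA Atv t₀ k i) / pnorm p (prodA Atv t₀ k j) ≤ δ₂) ∧
    (∀ Atv : ℕ → Matrix (Fin n) (Fin n) ℝ, Assumption1 Atv σl σu →
      ∀ t₀ k : ℕ, 1 ≤ k → ∀ i j : Fin n,
        σl ^ n / (σu ^ n * (n : ℝ) ^ n) ≤
          pnorm 1 (prodA Atv t₀ k i) / pnorm 1 (prodA Atv t₀ k j) ∧
        pnorm 1 (prodA Atv t₀ k i) / pnorm 1 (prodA Atv t₀ k j) ≤
          σu ^ n * (n : ℝ) ^ n / σl ^ n) := by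
  have hσu : 0 < σu := hσl.trans_le hσ
  have hn' : (0 : ℝ) < n := by exact_mod_cast hn
  refine ⟨fun p hp => ?_, fun Atv hA t₀ k _ i j => ?_⟩
  · set C : ℝ := σu ^ n * (n : ℝ) ^ n / σl ^ n with hC
    have hC0 : 0 < C := by positivity
    refine ⟨(n * C * n)⁻¹, n * C * n, by positivity, by positivity, fun Atv hA t₀ k _ i j => ?_⟩
    have hnn := prodA_nonneg hA t₀ k
    have hpos : ∀ i, 0 < pnorm p (prodA Atv t₀ k i) := fun i =>
      pos_of_mul_pos_right ((sum_prodA_pos hA t₀ k i).trans_le (sum_le_mul_pnorm hp _)) hn'.le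
    have hle : ∀ i j, pnorm p (prodA Atv t₀ k i) ≤ n * C * n * pnorm p (prodA Atv t₀ k j) := by
      intro i j
      calc pnorm p (prodA Atv t₀ k i) ≤ n * ∑ l, prodA Atv t₀ k i l :=
            pnorm_le_mul_sum hp hn (hnn i)
        _ ≤ n * (C * ∑ l, prodA Atv t₀ k j l) := by
            gcongr; exact sum_prodA_le_mul hA t₀ k i j
        _ ≤ n * (C * (n * pnorm p (prodA Atv t₀ k j))) := by
            gcongr; exact sum_le_mul_pnorm hp _
        _ = n * C * n * pnorm p (prodA Atv t₀ k j) := by ring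
    exact inv_le_div_and_div_le (hpos i) (hpos j) (hle i j) (hle j i)
  · rw [pnorm_one_of_nonneg (prodA_nonneg hA t₀ k i), pnorm_one_of_nonneg (prodA_nonneg hA t₀ k j),
      ← inv_div (σu ^ n * (n : ℝ) ^ n)]
    exact inv_le_div_and_div_le (sum_prodA_pos hA t₀ k i) (sum_prodA_pos hA t₀ k j)
      (sum_prodA_le_mul hA t₀ k i j) (sum_prodA_le_mul hA t₀ k j i)
end

section
/- Suppose the sequence of matrices A(t), t ≥ 0, satisfies Assumption 1, and let Ã(k,t₀) = A(t₀+k−1)A(t₀+k−2)⋯A(t₀). Then for every t₀ ≥ 0 there exists a unit vector v(t₀) ∈ S^{n-1} such that for every i ∈ {1,…,n} the sequence of Euclidean-normalized rows [Ã(k,t₀)]_i / ‖[Ã(k,t₀)]_i‖₂ converges to v(t₀) as k → ∞, and the convergence is linear: there exist constants C > 0 and q ∈ (0,1), independent of i and t₀, such that ‖[Ã(k,t₀)]_i/‖[Ã(k,t₀)]_i‖₂ − v(t₀)‖₂ ≤ C q^k for all k ≥ 1. -/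
open Finset Filter Topology Matrix

theorem prodA_add {n : ℕ} (A : ℕ → Matrix (Fin n) (Fin n) ℝ) (t k m : ℕ) :
    prodA A t (k + m) = prodA A (t + k) m * prodA A t k := by
  induction m with
  | zero => simp [prodA]
  | succ m ih =>
    rw [← add_assoc]
    simp only [prodA]
    rw [ih, Matrix.mul_assoc, add_assoc]

theorem prodA_nonneg_s5 {n : ℕ} {A : ℕ → Matrix (Fin n) (Fin n) ℝ} (hA : ∀ t i j, 0 ≤ A t i j)
    (t k : ℕ) (i j : Fin n) : 0 ≤ prodA A t k i j := by
  induction k generalizing i with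
  | zero =>
    simp only [prodA, Matrix.one_apply]
    split_ifs <;> norm_num
  | succ k ih =>
    simp only [prodA, Matrix.mul_apply]
    exact Finset.sum_nonneg fun l _ => mul_nonneg (hA _ _ _) (ih l)

theorem prodA_le {n : ℕ} {A : ℕ → Matrix (Fin n) (Fin n) ℝ} {σ : ℝ} (hσ : 0 ≤ σ)
    (hA : ∀ t i j, 0 ≤ A t i j) (hAσ : ∀ t i j, A t i j ≤ σ)
    (t k : ℕ) (i j : Fin n) : prodA A t k i j ≤ (n * σ) ^ k := by
  induction k generalizing i with
  | zero =>
    simp only [prodA, Matrix.one_apply]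
    split_ifs <;> norm_num
  | succ k ih =>
    simp only [prodA, Matrix.mul_apply]
    calc ∑ l, A (t + k) i l * prodA A t k l j
        ≤ ∑ _l : Fin n, σ * (n * σ) ^ k := Finset.sum_le_sum fun l _ =>
          mul_le_mul (hAσ _ _ _) (ih l) (prodA_nonneg_s5 hA _ _ _ _) hσ
      _ = (n * σ) ^ (k + 1) := by
          simp only [Finset.sum_const, Finset.card_univ, Fintype.card_fin, nsmul_eq_mul]
          ring

theorem pow_succ_le_prodA {n : ℕ} {A : ℕ → Matrix (Fin n) (Fin n) ℝ} {σ : ℝ} (hσ : 0 ≤ σ)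
    (hA : ∀ t i j, 0 ≤ A t i j) {t k : ℕ} {i l j : Fin n} (hil : σ ≤ A (t + k) i l)
    (hlj : σ ^ k ≤ prodA A t k l j) : σ ^ (k + 1) ≤ prodA A t (k + 1) i j := by
  simp only [prodA, Matrix.mul_apply]
  calc σ ^ (k + 1) = σ * σ ^ k := by ring
    _ ≤ A (t + k) i l * prodA A t k l j :=
        mul_le_mul hil hlj (pow_nonneg hσ _) (hσ.trans hil)
    _ ≤ _ := Finset.single_le_sum (f := fun l => A (t + k) i l * prodA A t k l j)
        (fun l _ => mul_nonneg (hA _ _ _) (prodA_nonneg_s5 hA _ _ _ _)) (Finset.mem_univ l)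

theorem pow_le_prodA_diag {n : ℕ} {A : ℕ → Matrix (Fin n) (Fin n) ℝ} {σ : ℝ} (hσ : 0 ≤ σ)
    (hA : ∀ t i j, 0 ≤ A t i j) (hdiag : ∀ t i, σ ≤ A t i i) (t k : ℕ) (i : Fin n) :
    σ ^ k ≤ prodA A t k i i := by
  induction k with
  | zero => simp [prodA]
  | succ k ih => exact pow_succ_le_prodA hσ hA (hdiag _ _) ih

/-- Products of sufficiently many weight matrices of a strongly connected graph with self-loops
have uniformly positive entries. -/
theorem exists_pow_le_prodA {n : ℕ} {A : ℕ → Matrix (Fin n) (Fin n) ℝ} {σ : ℝ} (hσ : 0 ≤ σ)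
    (hA : ∀ t i j, 0 ≤ A t i j) {E : Fin n → Fin n → Prop} (hloop : ∀ i, E i i)
    (hconn : ∀ i j, Relation.ReflTransGen E i j) (hE : ∀ t i j, E i j → σ ≤ A t i j) :
    ∃ N : ℕ, 1 ≤ N ∧ ∀ t i j, σ ^ N ≤ prodA A t N i j := by
  have key : ∀ i j, ∃ K : ℕ, ∀ k, K ≤ k → ∀ t, σ ^ k ≤ prodA A t k i j := by
    intro i j
    induction hconn i j using Relation.ReflTransGen.head_induction_on with
    | refl =>
      exact ⟨0, fun k _ t => pow_le_prodA_diag hσ hA (fun t i => hE t i i (hloop i)) t k j⟩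
    | head hil _ ih =>
      obtain ⟨K, hK⟩ := ih
      refine ⟨K + 1, fun k hk t => ?_⟩
      obtain ⟨k, rfl⟩ : ∃ m, k = m + 1 := ⟨k - 1, by omega⟩
      exact pow_succ_le_prodA hσ hA (hE _ _ _ hil) (hK k (by omega) t)
  choose K hK using key
  refine ⟨(∑ i, ∑ j, K i j) + 1, by omega, fun t i j => hK i j _ ?_ t⟩
  have h1 : K i j ≤ ∑ j, K i j := Finset.single_le_sum (fun _ _ => Nat.zero_le _) (mem_univ j)
  have h2 : ∑ j, K i j ≤ ∑ i, ∑ j, K i j :=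
    Finset.single_le_sum (f := fun i => ∑ j, K i j) (fun _ _ => Nat.zero_le _) (mem_univ i)
  omega

/-- The ratios `y i / s i` contract under a matrix whose entries lie in `[a, b]`, by the factor
`1 - a / b`. -/
theorem exists_ratio_contraction {ι : Type*} [Fintype ι] [Nonempty ι] {B : ι → ι → ℝ} {a b : ℝ}
    (ha : 0 ≤ a) (hb : 0 < b) (haB : ∀ i j, a ≤ B i j) (hBb : ∀ i j, B i j ≤ b)
    {y s : ι → ℝ} (hs : ∀ i, 0 < s i) {m M : ℝ} (hm : ∀ i, m * s i ≤ y i)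
    (hM : ∀ i, y i ≤ M * s i) :
    ∃ m' M' : ℝ, M' - m' = (1 - a / b) * (M - m) ∧
      ∀ i, m' * ∑ l, B i l * s l ≤ ∑ l, B i l * y l ∧
        ∑ l, B i l * y l ≤ M' * ∑ l, B i l * s l := by
  have hS : 0 < ∑ l, s l := Finset.sum_pos (fun i _ => hs i) Finset.univ_nonempty
  have hBs : ∀ i, ∑ l, B i l * s l ≤ b * ∑ l, s l := fun i => by
    rw [Finset.mul_sum]
    exact Finset.sum_le_sum fun l _ => mul_le_mul_of_nonneg_right (hBb i l) (hs l).le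
  have gap : ∀ z : ι → ℝ, (∀ l, 0 ≤ z l) → ∀ i,
      a / b * ((∑ l, z l) / ∑ l, s l) * ∑ l, B i l * s l ≤ ∑ l, B i l * z l := by
    intro z hz i
    have hZ : 0 ≤ ∑ l, z l := Finset.sum_nonneg fun l _ => hz l
    calc a / b * ((∑ l, z l) / ∑ l, s l) * ∑ l, B i l * s l
        ≤ a / b * ((∑ l, z l) / ∑ l, s l) * (b * ∑ l, s l) :=
          mul_le_mul_of_nonneg_left (hBs i) (by positivity)
      _ = ∑ l, a * z l := by
          rw [← Finset.mul_sum]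
          field_simp
      _ ≤ _ := Finset.sum_le_sum fun l _ => mul_le_mul_of_nonneg_right (haB i l) (hz l)
  refine ⟨m + a / b * ((∑ l, (y l - m * s l)) / ∑ l, s l),
    M - a / b * ((∑ l, (M * s l - y l)) / ∑ l, s l), ?_, fun i => ⟨?_, ?_⟩⟩
  · simp only [Finset.sum_sub_distrib, ← Finset.mul_sum]
    field_simp
    ring
  · have h := gap (fun l => y l - m * s l) (fun l => sub_nonneg.2 (hm l)) i
    have e : ∑ l, B i l * (y l - m * s l) = ∑ l, B i l * y l - m * ∑ l, B i l * s l := by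
      rw [Finset.mul_sum, ← Finset.sum_sub_distrib]
      exact Finset.sum_congr rfl fun l _ => by ring
    rw [e] at h
    rw [add_mul]
    linarith
  · have h := gap (fun l => M * s l - y l) (fun l => sub_nonneg.2 (hM l)) i
    have e : ∑ l, B i l * (M * s l - y l) = M * ∑ l, B i l * s l - ∑ l, B i l * y l := by
      rw [Finset.mul_sum, ← Finset.sum_sub_distrib]
      exact Finset.sum_congr rfl fun l _ => by ring
    rw [e] at h
    rw [sub_mul]
    linarith

theorem sum_prodA_add {n : ℕ} (A : ℕ → Matrix (Fin n) (Fin n) ℝ) (t k m : ℕ) (i : Fin n) :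
    ∑ j, prodA A t (k + m) i j = ∑ l, prodA A (t + k) m i l * ∑ j, prodA A t k l j := by
  simp only [prodA_add, Matrix.mul_apply, Finset.mul_sum]
  exact Finset.sum_comm

/-- Bounds on the ratios of entries to row sums persist under further multiplication. -/
theorem prodA_ratio_bounds_mono {n : ℕ} {A : ℕ → Matrix (Fin n) (Fin n) ℝ}
    (hA : ∀ t i j, 0 ≤ A t i j) {t k : ℕ} {j : Fin n} {m M : ℝ}
    (h : ∀ i, m * ∑ l, prodA A t k i l ≤ prodA A t k i j ∧
      prodA A t k i j ≤ M * ∑ l, prodA A t k i l) (d : ℕ) (i : Fin n) :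
    m * ∑ l, prodA A t (k + d) i l ≤ prodA A t (k + d) i j ∧
      prodA A t (k + d) i j ≤ M * ∑ l, prodA A t (k + d) i l := by
  rw [sum_prodA_add, prodA_add, Matrix.mul_apply, Finset.mul_sum, Finset.mul_sum]
  constructor <;> refine Finset.sum_le_sum fun l _ => ?_ <;> rw [mul_left_comm]
  · exact mul_le_mul_of_nonneg_left (h l).1 (prodA_nonneg_s5 hA _ _ _ _)
  · exact mul_le_mul_of_nonneg_left (h l).2 (prodA_nonneg_s5 hA _ _ _ _)

theorem exists_prodA_ratio_bounds {n : ℕ} {A : ℕ → Matrix (Fin n) (Fin n) ℝ}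
    (hA : ∀ t i j, 0 ≤ A t i j) (hs : ∀ t k i, 0 < ∑ l, prodA A t k i l) {N : ℕ} {a b : ℝ}
    (ha : 0 ≤ a) (hb : 0 < b) (haN : ∀ t i j, a ≤ prodA A t N i j)
    (hbN : ∀ t i j, prodA A t N i j ≤ b) (t : ℕ) (j : Fin n) (r : ℕ) :
    ∃ m M : ℝ, M - m = (1 - a / b) ^ r ∧
      ∀ i, m * ∑ l, prodA A t (r * N) i l ≤ prodA A t (r * N) i j ∧
        prodA A t (r * N) i j ≤ M * ∑ l, prodA A t (r * N) i l := by
  have : Nonempty (Fin n) := ⟨j⟩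
  induction r with
  | zero =>
    refine ⟨0, 1, by simp, fun i => ⟨?_, ?_⟩⟩
    · rw [zero_mul]
      exact prodA_nonneg_s5 hA _ _ _ _
    · rw [one_mul]
      exact Finset.single_le_sum (fun l _ => prodA_nonneg_s5 hA _ _ _ l) (mem_univ j)
  | succ r ih =>
    obtain ⟨m, M, hmM, h⟩ := ih
    obtain ⟨m', M', hmM', h'⟩ := exists_ratio_contraction ha hb (haN (t + r * N))
      (hbN (t + r * N)) (hs t (r * N)) (fun i => (h i).1) (fun i => (h i).2)
    refine ⟨m', M', by rw [hmM', hmM, pow_succ'], fun i => ?_⟩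
    rw [add_mul, one_mul, sum_prodA_add, prodA_add, Matrix.mul_apply]
    exact h' i

/-- The rows of the products, scaled to have unit sum, converge to a common limit. -/
theorem exists_limit_prodA_ratio {n : ℕ} {A : ℕ → Matrix (Fin n) (Fin n) ℝ}
    (hA : ∀ t i j, 0 ≤ A t i j) (hs : ∀ t k i, 0 < ∑ l, prodA A t k i l) {N : ℕ} {a b : ℝ}
    (hN : 1 ≤ N) (ha : 0 < a) (hab : a < b) (haN : ∀ t i j, a ≤ prodA A t N i j)
    (hbN : ∀ t i j, prodA A t N i j ≤ b) (t : ℕ) (j : Fin n) :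
    ∃ x : ℝ, ∀ k i,
      |(∑ l, prodA A t k i l)⁻¹ * prodA A t k i j - x| ≤ (1 - a / b) ^ (k / N) := by
  have hb : 0 < b := ha.trans hab
  have hθ0 : 0 ≤ 1 - a / b := sub_nonneg.2 ((div_le_one hb).2 hab.le)
  have hθ1 : 1 - a / b < 1 := by linarith [div_pos ha hb]
  have osc : ∀ k k' i i', k ≤ k' →
      |(∑ l, prodA A t k i l)⁻¹ * prodA A t k i j -
        (∑ l, prodA A t k' i' l)⁻¹ * prodA A t k' i' j| ≤ (1 - a / b) ^ (k / N) := by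
    intro k k' i i' hk
    obtain ⟨m, M, hmM, h⟩ := exists_prodA_ratio_bounds hA hs ha.le hb haN hbN t j (k / N)
    have hmem : ∀ p, k ≤ p → ∀ i, m ≤ (∑ l, prodA A t p i l)⁻¹ * prodA A t p i j ∧
        (∑ l, prodA A t p i l)⁻¹ * prodA A t p i j ≤ M := by
      intro p hp i
      obtain ⟨d, rfl⟩ := Nat.exists_eq_add_of_le ((Nat.div_mul_le_self k N).trans hp)
      have := prodA_ratio_bounds_mono hA h d i
      rw [inv_mul_eq_div, le_div_iff₀ (hs _ _ _), div_le_iff₀ (hs _ _ _)]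
      exact this
    have h1 := hmem k le_rfl i
    have h2 := hmem k' hk i'
    rw [← hmM, abs_le]
    constructor <;> linarith
  have hlim : Tendsto (fun k => (1 - a / b) ^ (k / N)) atTop (𝓝 0) :=
    (tendsto_pow_atTop_nhds_zero_of_lt_one hθ0 hθ1).comp (Nat.tendsto_div_const_atTop (by omega))
  have hcau : CauchySeq fun k => (∑ l, prodA A t k j l)⁻¹ * prodA A t k j j :=
    cauchySeq_of_le_tendsto_0' _ (fun k k' hk => by
      rw [Real.dist_eq]
      exact osc k k' j j hk) hlim
  obtain ⟨x, hx⟩ := cauchySeq_tendsto_of_complete hcau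
  refine ⟨x, fun k i => ?_⟩
  refine le_of_tendsto ((tendsto_const_nhds.sub hx).abs) ?_
  filter_upwards [eventually_ge_atTop k] with k' hk'
  exact osc k k' i j hk'

theorem norm_inv_smul_sub_le {V : Type*} [NormedAddCommGroup V] [NormedSpace ℝ V] {x w : V}
    (hx : x ≠ 0) (hw : w ≠ 0) :
    ‖‖x‖⁻¹ • x - ‖w‖⁻¹ • w‖ ≤ 2 * ‖w‖⁻¹ * ‖x - w‖ := by
  have hx' : 0 < ‖x‖ := norm_pos_iff.2 hx
  have hw' : 0 < ‖w‖ := norm_pos_iff.2 hw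
  have e : ‖x‖⁻¹ • x - ‖w‖⁻¹ • w = ‖w‖⁻¹ • (x - w) + (‖w‖⁻¹ * (‖w‖ - ‖x‖) * ‖x‖⁻¹) • x := by
    have : ‖w‖⁻¹ * (‖w‖ - ‖x‖) * ‖x‖⁻¹ = ‖x‖⁻¹ - ‖w‖⁻¹ := by field_simp
    rw [this]
    module
  rw [e]
  refine (norm_add_le _ _).trans ?_
  rw [norm_smul, norm_smul, norm_mul, norm_mul, norm_inv, norm_inv, norm_norm, norm_norm,
    mul_assoc (_ * _), inv_mul_cancel₀ hx'.ne', mul_one, Real.norm_eq_abs]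
  have : |‖w‖ - ‖x‖| ≤ ‖x - w‖ := by
    rw [norm_sub_rev]
    exact abs_norm_sub_norm_le w x
  have := mul_le_mul_of_nonneg_left this (inv_nonneg.2 hw'.le)
  linarith

theorem euclNorm_eq_norm {d : ℕ} (x : Fin d → ℝ) : euclNorm x = ‖WithLp.toLp 2 x‖ := by
  simp [euclNorm, EuclideanSpace.norm_eq]

theorem euclNorm_smul {d : ℕ} (c : ℝ) (x : Fin d → ℝ) : euclNorm (c • x) = |c| * euclNorm x := by
  rw [euclNorm_eq_norm, euclNorm_eq_norm, WithLp.toLp_smul, norm_smul, Real.norm_eq_abs]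

theorem abs_le_euclNorm {d : ℕ} (x : Fin d → ℝ) (j : Fin d) : |x j| ≤ euclNorm x := by
  rw [euclNorm_eq_norm]
  exact PiLp.norm_apply_le (WithLp.toLp 2 x) j

theorem euclNorm_le_card_mul {d : ℕ} {x : Fin d → ℝ} {ε : ℝ} (hd : 1 ≤ d)
    (hx : ∀ j, |x j| ≤ ε) : euclNorm x ≤ d * ε := by
  have hε : 0 ≤ ε := (abs_nonneg _).trans (hx ⟨0, hd⟩)
  refine Real.sqrt_le_iff.2 ⟨by positivity, ?_⟩
  have hd' : (1 : ℝ) ≤ d := by exact_mod_cast hd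
  calc ∑ j, x j ^ 2 ≤ ∑ _j : Fin d, ε ^ 2 :=
        Finset.sum_le_sum fun j _ => sq_le_sq' (abs_le.1 (hx j)).1 (abs_le.1 (hx j)).2
    _ = d * ε ^ 2 := by simp
    _ ≤ (d * ε) ^ 2 := by nlinarith [sq_nonneg ε]

theorem one_le_card_mul_euclNorm {d : ℕ} {x : Fin d → ℝ} (hx : ∑ j, x j = 1) :
    1 ≤ d * euclNorm x := by
  calc (1 : ℝ) = ∑ j, x j := hx.symm
    _ ≤ ∑ _j : Fin d, euclNorm x :=
        Finset.sum_le_sum fun j _ => (le_abs_self _).trans (abs_le_euclNorm x j)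
    _ = d * euclNorm x := by simp

theorem euclNorm_normalize_sub_le {d : ℕ} (hd : 1 ≤ d) {x w : Fin d → ℝ} {c ε : ℝ} (hc : 0 < c)
    (hx : ∑ j, (c • x) j = 1) (hw : ∑ j, w j = 1) (h : ∀ j, |c * x j - w j| ≤ ε) :
    euclNorm ((euclNorm x)⁻¹ • x - (euclNorm w)⁻¹ • w) ≤ 2 * d ^ 2 * ε := by
  have hd0 : (0 : ℝ) < d := by exact_mod_cast hd
  have pos : ∀ z : Fin d → ℝ, ∑ j, z j = 1 → 0 < euclNorm z := fun z hz => by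
    have := one_le_card_mul_euclNorm hz
    by_contra hneg
    nlinarith [mul_nonneg hd0.le (sub_nonneg.2 (not_lt.1 hneg))]
  have hscale : (euclNorm x)⁻¹ • x = (euclNorm (c • x))⁻¹ • (c • x) := by
    rw [euclNorm_smul, abs_of_pos hc, smul_smul, _root_.mul_inv_rev, mul_assoc, inv_mul_cancel₀ hc.ne',
      mul_one]
  have hxpos := pos _ hx
  have hwpos := pos _ hw
  have hdiff : euclNorm (c • x - w) ≤ d * ε := euclNorm_le_card_mul hd h
  have hwinv : (euclNorm w)⁻¹ ≤ d := by
    rw [inv_le_iff_one_le_mul₀ hwpos]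
    exact one_le_card_mul_euclNorm hw
  rw [hscale]
  have key : euclNorm ((euclNorm (c • x))⁻¹ • (c • x) - (euclNorm w)⁻¹ • w) ≤
      2 * (euclNorm w)⁻¹ * euclNorm (c • x - w) := by
    simp only [euclNorm_eq_norm] at hxpos hwpos ⊢
    exact norm_inv_smul_sub_le (norm_pos_iff.1 hxpos) (norm_pos_iff.1 hwpos)
  calc _ ≤ 2 * (euclNorm w)⁻¹ * euclNorm (c • x - w) := key
    _ ≤ 2 * d * (d * ε) := mul_le_mul (by linarith) hdiff (Real.sqrt_nonneg _) (by positivity)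
    _ = 2 * d ^ 2 * ε := by ring

theorem exists_pow_div_le {θ : ℝ} (h0 : 0 < θ) (h1 : θ < 1) {N : ℕ} (hN : 1 ≤ N) :
    ∃ q : ℝ, 0 < q ∧ q < 1 ∧ ∀ k : ℕ, θ ^ (k / N) ≤ θ⁻¹ * q ^ k := by
  have hN0 : (0 : ℝ) < N := by exact_mod_cast hN
  have hq0 : 0 < θ ^ ((N : ℝ)⁻¹) := Real.rpow_pos_of_pos h0 _
  have hq1 : θ ^ ((N : ℝ)⁻¹) < 1 := Real.rpow_lt_one h0.le h1 (inv_pos.2 hN0)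
  refine ⟨θ ^ ((N : ℝ)⁻¹), hq0, hq1, fun k => ?_⟩
  have hpow : (θ ^ ((N : ℝ)⁻¹)) ^ N = θ := Real.rpow_inv_natCast_pow h0.le (by omega)
  rw [inv_mul_eq_div, le_div_iff₀ h0, ← pow_succ]
  calc θ ^ (k / N + 1) = (θ ^ ((N : ℝ)⁻¹)) ^ (N * (k / N + 1)) := by rw [pow_mul, hpow]
    _ ≤ _ := pow_le_pow_of_le_one hq0.le hq1.le (Nat.lt_mul_div_succ k hN).le

theorem stmt5 {n : ℕ} (hn : 1 ≤ n) (Atv : ℕ → Matrix (Fin n) (Fin n) ℝ) (σl σu : ℝ)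
    (hA : Assumption1 Atv σl σu) :
    ∃ C q : ℝ, 0 < C ∧ 0 < q ∧ q < 1 ∧
      ∀ t₀ : ℕ, ∃ v : Fin n → ℝ, euclNorm v = 1 ∧
        (∀ i, Tendsto (fun k => (euclNorm (prodA Atv t₀ k i))⁻¹ • prodA Atv t₀ k i)
          atTop (𝓝 v)) ∧
        ∀ i : Fin n, ∀ k : ℕ, 1 ≤ k →
          euclNorm ((euclNorm (prodA Atv t₀ k i))⁻¹ • prodA Atv t₀ k i - v) ≤ C * q ^ k := by
  obtain ⟨hσ, hσlu, E, hloop, hconn, hE⟩ := hA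
  have hpos : ∀ t i j, 0 ≤ Atv t i j := fun t i j => by
    by_cases h : E i j
    · exact hσ.le.trans ((hE t i j).1 h).1
    · exact ((hE t i j).2 h).ge
  have hle : ∀ t i j, Atv t i j ≤ σu := fun t i j => by
    by_cases h : E i j
    · exact ((hE t i j).1 h).2
    · exact ((hE t i j).2 h).trans_le (hσ.le.trans hσlu)
  have hn0 : (0 : ℝ) < n := by exact_mod_cast hn
  have hσu : 0 < σu := hσ.trans_le hσlu
  have hs : ∀ t k i, 0 < ∑ l, prodA Atv t k i l := fun t k i =>
    (pow_pos hσ k).trans_le <|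
      (pow_le_prodA_diag hσ.le hpos (fun t i => ((hE t i i).1 (hloop i)).1) t k i).trans <|
        Finset.single_le_sum (fun l _ => prodA_nonneg_s5 hpos _ _ _ l) (mem_univ i)
  obtain ⟨N, hN, haN⟩ := exists_pow_le_prodA hσ.le hpos hloop hconn
    fun t i j h => ((hE t i j).1 h).1
  have ha : 0 < σl ^ N := pow_pos hσ N
  have hab : σl ^ N < (n * σu) ^ N + σl ^ N := by linarith [pow_pos (mul_pos hn0 hσu) N]
  have hbN : ∀ t i j, prodA Atv t N i j ≤ (n * σu) ^ N + σl ^ N := fun t i j =>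
    (prodA_le hσu.le hpos hle t N i j).trans (by linarith)
  have hlim := exists_limit_prodA_ratio hpos hs hN ha hab haN hbN
  have hθ0 : 0 < 1 - σl ^ N / ((n * σu) ^ N + σl ^ N) :=
    sub_pos.2 ((div_lt_one (ha.trans hab)).2 hab)
  have hθ1 : 1 - σl ^ N / ((n * σu) ^ N + σl ^ N) < 1 := by
    linarith [div_pos ha (ha.trans hab)]
  set θ := 1 - σl ^ N / ((n * σu) ^ N + σl ^ N)
  obtain ⟨q, hq0, hq1, hq⟩ := exists_pow_div_le hθ0 hθ1 hN
  refine ⟨2 * n ^ 2 * θ⁻¹, q, by positivity, hq0, hq1, fun t => ?_⟩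
  choose x hx using hlim t
  have hθlim : Tendsto (fun k => θ ^ (k / N)) atTop (𝓝 0) :=
    (tendsto_pow_atTop_nhds_zero_of_lt_one hθ0.le hθ1).comp
      (Nat.tendsto_div_const_atTop (by omega))
  have hrow : ∀ k i, ∑ j, ((∑ l, prodA Atv t k i l)⁻¹ • prodA Atv t k i) j = 1 := fun k i => by
    simp only [Pi.smul_apply, smul_eq_mul, ← Finset.mul_sum]
    exact inv_mul_cancel₀ (hs t k i).ne'
  have hxsum : ∑ j, x j = 1 := by
    have hconv : Tendsto (fun k => ∑ j, ((∑ l, prodA Atv t k ⟨0, hn⟩ l)⁻¹ •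
        prodA Atv t k ⟨0, hn⟩) j) atTop (𝓝 (∑ j, x j)) := by
      refine tendsto_finsetSum _ fun j _ => ?_
      rw [tendsto_iff_dist_tendsto_zero]
      exact squeeze_zero (fun _ => dist_nonneg) (fun k => hx j k ⟨0, hn⟩) hθlim
    simp only [hrow] at hconv
    exact tendsto_nhds_unique hconv tendsto_const_nhds
  have hbound : ∀ i k, euclNorm ((euclNorm (prodA Atv t k i))⁻¹ • prodA Atv t k i -
      (euclNorm x)⁻¹ • x) ≤ 2 * n ^ 2 * θ⁻¹ * q ^ k := fun i k =>
    calc _ ≤ 2 * n ^ 2 * θ ^ (k / N) := euclNorm_normalize_sub_le hn (inv_pos.2 (hs t k i))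
          (hrow k i) hxsum fun j => hx j k i
      _ ≤ 2 * n ^ 2 * (θ⁻¹ * q ^ k) := mul_le_mul_of_nonneg_left (hq k) (by positivity)
      _ = _ := by ring
  refine ⟨(euclNorm x)⁻¹ • x, ?_, fun i => ?_, fun i k _ => hbound i k⟩
  · have hx0 : euclNorm x ≠ 0 := fun h => by
      have := one_le_card_mul_euclNorm hxsum
      rw [h] at this
      linarith
    rw [euclNorm_smul, abs_inv, abs_of_nonneg (show 0 ≤ euclNorm x from Real.sqrt_nonneg _),
      inv_mul_cancel₀ hx0]
  · refine tendsto_pi_nhds.2 fun j => ?_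
    rw [tendsto_iff_dist_tendsto_zero]
    refine squeeze_zero (fun _ => dist_nonneg)
      (fun k => (abs_le_euclNorm _ j).trans (hbound i k)) ?_
    simpa using (tendsto_pow_atTop_nhds_zero_of_lt_one hq0.le hq1).const_mul (2 * n ^ 2 * θ⁻¹)
end

section
/- Let Z ∈ ℝ^{n×m} be a matrix with strictly positive entries whose rows z₁,…,zₙ have Euclidean norm 1, and let c = min_{1≤i,j≤n} ⟨z_i, z_j⟩ (note 0 < c ≤ 1). Let B ∈ ℝ^{n×n} be a row-stochastic matrix all of whose entries are at least δ, where 0 < δ. For each i define z'_i = (Σⱼ [B]_{ij} z_j)/‖Σⱼ [B]_{ij} z_j‖₂. Then min_{1≤i,j≤n} ⟨z'_i, z'_j⟩ ≥ c / (1 − δ²(1 − c)). -/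
open Finset Matrix

section ConvexCombinations

variable {n m : ℕ} {z : Fin n → Fin m → ℝ} {a b : Fin n → ℝ} {c δ : ℝ}

/-- The inner product of two linear combinations, expanded through the Gram matrix. -/
lemma sum_smul_mul_sum_smul (z : Fin n → Fin m → ℝ) (a b : Fin n → ℝ) :
    ∑ t, (∑ l, a l • z l) t * (∑ l, b l • z l) t =
      ∑ k, ∑ l, a k * b l * ∑ t, z k t * z l t := by
  simp only [Finset.sum_apply, Pi.smul_apply, smul_eq_mul, Finset.sum_mul_sum]
  rw [Finset.sum_comm]
  refine Finset.sum_congr rfl fun k _ => ?_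
  rw [Finset.sum_comm]
  refine Finset.sum_congr rfl fun l _ => ?_
  rw [Finset.mul_sum]
  exact Finset.sum_congr rfl fun t _ => by ring

lemma sum_sum_mul_eq_one (ha1 : ∑ l, a l = 1) (hb1 : ∑ l, b l = 1) :
    ∑ k, ∑ l, a k * b l = 1 := by
  rw [← Finset.sum_mul_sum, ha1, hb1, one_mul]

/-- Two convex combinations of unit vectors with pairwise inner products at least `c`, the weights
being at least `δ`, have inner product at least `c + (1 - c) * δ`. -/
lemma le_inner_convex_combinations (hunit : ∀ i, ∑ t, z i t * z i t = 1)
    (hcle : ∀ i j, c ≤ ∑ t, z i t * z j t) (hc1 : c ≤ 1)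
    (ha : ∀ l, 0 ≤ a l) (hb0 : ∀ l, 0 ≤ b l) (hb : ∀ l, δ ≤ b l)
    (ha1 : ∑ l, a l = 1) (hb1 : ∑ l, b l = 1) :
    c + (1 - c) * δ ≤ ∑ t, (∑ l, a l • z l) t * (∑ l, b l • z l) t := by
  have hdiag : δ ≤ ∑ k, a k * b k := by
    calc δ = ∑ k, a k * δ := by rw [← Finset.sum_mul, ha1, one_mul]
      _ ≤ _ := Finset.sum_le_sum fun k _ => mul_le_mul_of_nonneg_left (hb k) (ha k)
  calc c + (1 - c) * δ ≤ c + (1 - c) * ∑ k, a k * b k := by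
        gcongr
    _ = ∑ k, ∑ l, a k * b l * (c + if k = l then 1 - c else 0) := by
        simp only [mul_add, Finset.sum_add_distrib, ← Finset.sum_mul,
          sum_sum_mul_eq_one ha1 hb1, mul_ite, mul_zero, Finset.sum_ite_eq, Finset.mem_univ,
          if_true]
        ring
    _ ≤ ∑ k, ∑ l, a k * b l * ∑ t, z k t * z l t := by
        refine Finset.sum_le_sum fun k _ => Finset.sum_le_sum fun l _ =>
          mul_le_mul_of_nonneg_left ?_ (mul_nonneg (ha k) (hb0 l))
        split_ifs with h
        · subst h; linarith [hunit k]
        · linarith [hcle k l]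
    _ = _ := (sum_smul_mul_sum_smul z a b).symm

lemma inner_le_one_of_unit (hunit : ∀ i, ∑ t, z i t * z i t = 1) (k l : Fin n) :
    ∑ t, z k t * z l t ≤ 1 := by
  have h : ∑ t, 2 * (z k t * z l t) ≤ ∑ t, (z k t * z k t + z l t * z l t) :=
    Finset.sum_le_sum fun t _ => by nlinarith [sq_nonneg (z k t - z l t)]
  rw [Finset.sum_add_distrib, hunit, hunit, ← Finset.mul_sum] at h
  linarith

/-- A convex combination of unit vectors has Euclidean norm at most `1`. -/
lemma euclNorm_convex_combination_le_one (hunit : ∀ i, ∑ t, z i t * z i t = 1)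
    (ha : ∀ l, 0 ≤ a l) (ha1 : ∑ l, a l = 1) : euclNorm (∑ l, a l • z l) ≤ 1 := by
  rw [euclNorm, Real.sqrt_le_one]
  simp only [pow_two]
  rw [sum_smul_mul_sum_smul, ← sum_sum_mul_eq_one ha1 ha1]
  exact Finset.sum_le_sum fun k _ => Finset.sum_le_sum fun l _ =>
    mul_le_of_le_one_right (mul_nonneg (ha k) (ha l)) (inner_le_one_of_unit hunit k l)

end ConvexCombinations

theorem stmt7 {n m : ℕ} (hn : 0 < n) (z : Fin n → Fin m → ℝ)
    (hpos : ∀ i t, 0 < z i t) (hunit : ∀ i, euclNorm (z i) = 1)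
    (c : ℝ) (hc : IsLeast {r : ℝ | ∃ i j : Fin n, r = ∑ t, z i t * z j t} c)
    (δ : ℝ) (hδ : 0 < δ) (B : Matrix (Fin n) (Fin n) ℝ)
    (hBδ : ∀ i j, δ ≤ B i j) (hBrs : ∀ i, ∑ j, B i j = 1) :
    ∀ i j : Fin n,
      c / (1 - δ ^ 2 * (1 - c)) ≤
        ∑ t, ((euclNorm (∑ l, B i l • z l))⁻¹ • ∑ l, B i l • z l) t *
             ((euclNorm (∑ l, B j l • z l))⁻¹ • ∑ l, B j l • z l) t := by
  have hinner : ∀ i, ∑ t, z i t * z i t = 1 := fun i => by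
    have h := hunit i
    rw [euclNorm, Real.sqrt_eq_one] at h
    simpa only [pow_two] using h
  have hcle : ∀ i j, c ≤ ∑ t, z i t * z j t := fun i j => hc.2 ⟨i, j, rfl⟩
  have hc1 : c ≤ 1 := (hcle ⟨0, hn⟩ ⟨0, hn⟩).trans_eq (hinner _)
  have hc0 : 0 < c := by
    obtain ⟨p, q, hpq⟩ := hc.1
    have hne : (Finset.univ : Finset (Fin m)).Nonempty := by
      rw [Finset.nonempty_iff_ne_empty]
      intro h
      simpa [h] using hinner p
    rw [hpq]
    exact Finset.sum_pos (fun t _ => mul_pos (hpos p t) (hpos q t)) hne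
  have hB0 : ∀ i j, 0 ≤ B i j := fun i j => hδ.le.trans (hBδ i j)
  have hδ1 : δ ≤ 1 := by
    refine (hBδ ⟨0, hn⟩ ⟨0, hn⟩).trans ?_
    rw [← hBrs ⟨0, hn⟩]
    exact Finset.single_le_sum (fun l _ => hB0 _ l) (Finset.mem_univ _)
  have hlow : ∀ i j, c + (1 - c) * δ ≤ ∑ t, (∑ l, B i l • z l) t * (∑ l, B j l • z l) t :=
    fun i j => le_inner_convex_combinations hinner hcle hc1 (hB0 i) (hB0 j) (hBδ j)
      (hBrs i) (hBrs j)
  have hcδ : 0 < c + (1 - c) * δ := by nlinarith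
  have hnorm_pos : ∀ i, 0 < euclNorm (∑ l, B i l • z l) := fun i => by
    rw [euclNorm, Real.sqrt_pos]
    simp only [pow_two]
    exact hcδ.trans_le (hlow i i)
  have hnorm_le : ∀ i, euclNorm (∑ l, B i l • z l) ≤ 1 := fun i =>
    euclNorm_convex_combination_le_one hinner (hB0 i) (hBrs i)
  intro i j
  have hbound : c / (1 - δ ^ 2 * (1 - c)) ≤ c + (1 - c) * δ := by
    have hcδ1 : c + (1 - c) * δ ≤ 1 := by nlinarith
    have hδδ : δ ^ 2 ≤ 1 := pow_le_one₀ hδ.le hδ1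
    rw [div_le_iff₀ (by nlinarith)]
    have h : 0 ≤ (1 - c) * δ * (1 - δ * (c + (1 - c) * δ)) :=
      mul_nonneg (mul_nonneg (by linarith) hδ.le) (by nlinarith)
    linarith
  have hfactor : ∑ t, ((euclNorm (∑ l, B i l • z l))⁻¹ • ∑ l, B i l • z l) t *
      ((euclNorm (∑ l, B j l • z l))⁻¹ • ∑ l, B j l • z l) t =
      (euclNorm (∑ l, B i l • z l))⁻¹ * (euclNorm (∑ l, B j l • z l))⁻¹ *
        ∑ t, (∑ l, B i l • z l) t * (∑ l, B j l • z l) t := by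
    rw [Finset.mul_sum]
    refine Finset.sum_congr rfl fun t _ => ?_
    rw [Pi.smul_apply, Pi.smul_apply, smul_eq_mul, smul_eq_mul]
    ring
  rw [hfactor]
  refine (hbound.trans (hlow i j)).trans
    (le_mul_of_one_le_left (hcδ.le.trans (hlow i j)) ?_)
  exact one_le_mul_of_one_le_of_one_le ((one_le_inv₀ (hnorm_pos i)).2 (hnorm_le i))
    ((one_le_inv₀ (hnorm_pos j)).2 (hnorm_le j))
end

section
/- Let δ ∈ (0,1) and let (e_s)_{s≥1} be a sequence with 0 ≤ e_s < 1 for all s and satisfying 1 − e_{s+1} ≥ (1 − e_s)/(1 − δ² e_s) for all s ≥ 1. Then the sequence (e_s) is nonincreasing, e_{s+1} ≤ ((1 − δ²)/(1 − δ² e₁)) · e_s for all s ≥ 1, and consequently e_s converges to 0 linearly (at geometric rate q = (1 − δ²)/(1 − δ² e₁) < 1). -/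
open Filter Topology

theorem stmt8 (δ : ℝ) (hδ : 0 < δ) (hδ1 : δ < 1) (e : ℕ → ℝ)
    (he : ∀ s, 1 ≤ s → 0 ≤ e s ∧ e s < 1)
    (hrec : ∀ s, 1 ≤ s → (1 - e s) / (1 - δ ^ 2 * e s) ≤ 1 - e (s + 1)) :
    (∀ s, 1 ≤ s → e (s + 1) ≤ e s) ∧
    (∀ s, 1 ≤ s → e (s + 1) ≤ ((1 - δ ^ 2) / (1 - δ ^ 2 * e 1)) * e s) ∧
    (1 - δ ^ 2) / (1 - δ ^ 2 * e 1) < 1 ∧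
    Tendsto e atTop (𝓝 0) := by
  have hd0 : 0 < δ ^ 2 := by positivity
  have hd1 : δ ^ 2 < 1 := by nlinarith
  have hlt : ∀ s, 1 ≤ s → 1 - δ ^ 2 < 1 - δ ^ 2 * e s := fun s hs => by
    nlinarith [he s hs]
  have hpos : ∀ s, 1 ≤ s → 0 < 1 - δ ^ 2 * e s := fun s hs => by
    linarith [hlt s hs]
  have hq : ∀ s, 1 ≤ s → (1 - δ ^ 2) / (1 - δ ^ 2 * e s) < 1 := fun s hs =>
    (div_lt_one (hpos s hs)).2 (hlt s hs)
  have hstep : ∀ s, 1 ≤ s → e (s + 1) ≤ (1 - δ ^ 2) / (1 - δ ^ 2 * e s) * e s := by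
    intro s hs
    have hne := (hpos s hs).ne'
    have heq : (1 - δ ^ 2) / (1 - δ ^ 2 * e s) * e s
        = 1 - (1 - e s) / (1 - δ ^ 2 * e s) := by
      field_simp
      ring
    linarith [hrec s hs]
  have hmono : ∀ s, 1 ≤ s → e (s + 1) ≤ e s := fun s hs =>
    (hstep s hs).trans (mul_le_of_le_one_left (he s hs).1 (hq s hs).le)
  have hle : ∀ s, 1 ≤ s → e s ≤ e 1 := fun s hs =>
    Nat.le_induction le_rfl (fun n hn ih => (hmono n hn).trans ih) s hs
  have hgeom : ∀ s, 1 ≤ s → e (s + 1) ≤ (1 - δ ^ 2) / (1 - δ ^ 2 * e 1) * e s := by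
    intro s hs
    refine (hstep s hs).trans (mul_le_mul_of_nonneg_right ?_ (he s hs).1)
    refine div_le_div_of_nonneg_left (by linarith) (hpos 1 le_rfl) ?_
    nlinarith [hle s hs]
  refine ⟨hmono, hgeom, hq 1 le_rfl, ?_⟩
  have hq0 : 0 ≤ (1 - δ ^ 2) / (1 - δ ^ 2 * e 1) :=
    div_nonneg (by linarith) (hpos 1 le_rfl).le
  have hq1 := hq 1 le_rfl
  generalize (1 - δ ^ 2) / (1 - δ ^ 2 * e 1) = q at hgeom hq0 hq1
  have hbound : ∀ n, e (n + 1) ≤ q ^ n * e 1 := by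
    intro n
    induction n with
    | zero => simp
    | succ n ih =>
      calc e (n + 1 + 1) ≤ q * e (n + 1) := hgeom (n + 1) (by omega)
        _ ≤ q * (q ^ n * e 1) := mul_le_mul_of_nonneg_left ih hq0
        _ = q ^ (n + 1) * e 1 := by ring
  rw [← tendsto_add_atTop_iff_nat 1]
  refine squeeze_zero (fun n => (he (n + 1) (by omega)).1) hbound ?_
  simpa using (tendsto_pow_atTop_nhds_zero_of_lt_one hq0 hq1).mul_const (e 1)
end

section
/- Suppose the matrix A together with γ̄ satisfies Assumption 2, let X(t) be generated by the algorithm from X₀ ∈ S(n,d,γ̄), and let v(X₀) ∈ S^{n-1} be the strictly positive unit vector to which all Euclidean-normalized rows of Ã(k,t₀,X₀) converge. If asymptotic consensus of directions holds, i.e., ‖x_i(t)/‖x_i(t)‖₂ − x_j(t)/‖x_j(t)‖₂‖₂ → 0 as t → ∞ for all i, j, then the row vector v(X₀)X₀ ∈ ℝ^d is nonzero. -/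
open Finset Filter Topology Matrix

theorem euclNorm_nonneg {d : ℕ} (x : Fin d → ℝ) : 0 ≤ euclNorm x := Real.sqrt_nonneg _

theorem euclNorm_sq {d : ℕ} (x : Fin d → ℝ) : euclNorm x ^ 2 = x ⬝ᵥ x := by
  rw [euclNorm, Real.sq_sqrt (Finset.sum_nonneg fun _ _ => sq_nonneg _)]
  simp only [dotProduct, sq]

theorem euclNorm_eq_zero_iff {d : ℕ} {x : Fin d → ℝ} : euclNorm x = 0 ↔ x = 0 := by
  rw [← dotProduct_self_eq_zero (v := x), ← euclNorm_sq, sq_eq_zero_iff]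

theorem euclNorm_pos {d : ℕ} {x : Fin d → ℝ} (hx : x ≠ 0) : 0 < euclNorm x :=
  (euclNorm_nonneg x).lt_of_ne fun h => hx (euclNorm_eq_zero_iff.1 h.symm)

theorem dotProduct_self_normalize {d : ℕ} {x : Fin d → ℝ} (hx : x ≠ 0) :
    ((euclNorm x)⁻¹ • x) ⬝ᵥ ((euclNorm x)⁻¹ • x) = 1 := by
  have h := (euclNorm_pos hx).ne'
  rw [smul_dotProduct, dotProduct_smul, ← euclNorm_sq, smul_eq_mul, smul_eq_mul]
  field_simp

theorem normalize_mem_unitSphere {d : ℕ} {x : Fin d → ℝ} (hx : x ≠ 0) :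
    (euclNorm x)⁻¹ • x ∈ unitSphere d := by
  have h := dotProduct_self_normalize hx
  rw [← euclNorm_sq] at h
  exact (pow_eq_one_iff_of_nonneg (euclNorm_nonneg _) two_ne_zero).1 h

/-- Nonzero vectors whose directions are at distance less than `1`:
each has a positive component along the direction of the other. -/
theorem dotProduct_normalize_pos {d : ℕ} {x y : Fin d → ℝ} (hx : x ≠ 0) (hy : y ≠ 0)
    (hxy : euclNorm ((euclNorm x)⁻¹ • x - (euclNorm y)⁻¹ • y) < 1) :
    0 < x ⬝ᵥ ((euclNorm y)⁻¹ • y) := by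
  have hp := dotProduct_self_normalize hx
  have hq := dotProduct_self_normalize hy
  have hsq := (sq_lt_one_iff₀ (euclNorm_nonneg _)).2 hxy
  rw [euclNorm_sq, sub_dotProduct, dotProduct_sub, dotProduct_sub, hp, hq,
    dotProduct_comm ((euclNorm y)⁻¹ • y)] at hsq
  have hpq : 0 < ((euclNorm x)⁻¹ • x) ⬝ᵥ ((euclNorm y)⁻¹ • y) := by linarith
  rw [smul_dotProduct, smul_eq_mul] at hpq
  exact pos_of_mul_pos_right hpq (inv_nonneg.2 (euclNorm_nonneg x))

theorem rowProj_eq_Dmat_mul {n d : ℕ} (γbar : Fin n → (Fin d → ℝ) → ℝ)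
    (B : Matrix (Fin n) (Fin d) ℝ) : rowProj γbar B = Dmat γbar B * B := by
  ext i j
  simp only [rowProj, radialProj, Dmat, Matrix.of_apply, Matrix.diagonal_mul, Pi.smul_apply,
    smul_eq_mul, div_eq_mul_inv, mul_assoc]

theorem traj_succ {n d : ℕ} (A : Matrix (Fin n) (Fin n) ℝ) (γbar : Fin n → (Fin d → ℝ) → ℝ)
    (X₀ : Matrix (Fin n) (Fin d) ℝ) (k : ℕ) :
    traj A γbar X₀ (k + 1) =
      Dmat γbar (A * traj A γbar X₀ k) * A * traj A γbar X₀ k := by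
  rw [traj, rowProj_eq_Dmat_mul, Matrix.mul_assoc]

theorem traj_eq_Atilde_mul {n d : ℕ} (A : Matrix (Fin n) (Fin n) ℝ)
    (γbar : Fin n → (Fin d → ℝ) → ℝ) (X₀ : Matrix (Fin n) (Fin d) ℝ) (k : ℕ) :
    traj A γbar X₀ k = Atilde A γbar X₀ k * X₀ := by
  induction k with
  | zero => simp [traj, Atilde]
  | succ k ih =>
    rw [traj_succ, Atilde, Matrix.mul_assoc _ (Atilde A γbar X₀ k), ← ih]

theorem Dmat_mul_nonneg {n d : ℕ} {A : Matrix (Fin n) (Fin n) ℝ}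
    {γbar : Fin n → (Fin d → ℝ) → ℝ} (hA : ∀ i j, 0 ≤ A i j)
    (hγ : ∀ i, IsDirectional (γbar i)) (B : Matrix (Fin n) (Fin d) ℝ) (i j : Fin n) :
    0 ≤ (Dmat γbar B * A) i j := by
  rw [Dmat, Matrix.diagonal_mul]
  refine mul_nonneg ?_ (hA i j)
  by_cases h : B i = 0
  · simp [euclNorm_eq_zero_iff.2 h]
  · obtain ⟨-, c, C, hc, hcC⟩ := hγ i
    exact div_nonneg (hc.le.trans (hcC _ (normalize_mem_unitSphere h)).1) (euclNorm_nonneg _)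

theorem traj_succ_row_ne_zero {n d : ℕ} {A : Matrix (Fin n) (Fin n) ℝ}
    {γbar : Fin n → (Fin d → ℝ) → ℝ} {X₀ : Matrix (Fin n) (Fin d) ℝ} {k : ℕ} {i : Fin n}
    (h : Atilde A γbar X₀ (k + 1) i ≠ 0) : traj A γbar X₀ (k + 1) i ≠ 0 := by
  set B := A * traj A γbar X₀ k with hB
  have hrow : traj A γbar X₀ (k + 1) i =
      (γbar i ((euclNorm (B i))⁻¹ • B i) / euclNorm (B i)) • B i := by
    rw [traj, rowProj_eq_Dmat_mul, ← hB]
    ext j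
    simp [Dmat, Matrix.diagonal_mul]
  have hD : γbar i ((euclNorm (B i))⁻¹ • B i) / euclNorm (B i) ≠ 0 := by
    intro h0
    refine h ?_
    ext j
    rw [Atilde, Matrix.mul_assoc, ← hB, Dmat, Matrix.diagonal_mul, h0, zero_mul, Pi.zero_apply]
  rw [hrow]
  exact smul_ne_zero hD fun h0 => (div_ne_zero_iff.1 hD).2 (euclNorm_eq_zero_iff.2 h0)

/-- A componentwise comparison `Ã(T) w ≤ X(T) u` propagates forward in time, since both sides
evolve under the same nonnegative matrices. -/
theorem le_traj_mulVec_of_le {n d : ℕ} {A : Matrix (Fin n) (Fin n) ℝ}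
    {γbar : Fin n → (Fin d → ℝ) → ℝ} (hA : ∀ i j, 0 ≤ A i j)
    (hγ : ∀ i, IsDirectional (γbar i)) {X₀ : Matrix (Fin n) (Fin d) ℝ}
    {u : Fin d → ℝ} {w : Fin n → ℝ} {T : ℕ}
    (hT : Atilde A γbar X₀ T *ᵥ w ≤ traj A γbar X₀ T *ᵥ u) {k : ℕ} (hk : T ≤ k) :
    Atilde A γbar X₀ k *ᵥ w ≤ traj A γbar X₀ k *ᵥ u := by
  induction k, hk using Nat.le_induction with
  | base => exact hT
  | succ k _ ih =>
    rw [traj_succ, Atilde, ← Matrix.mulVec_mulVec _ _ (Atilde A γbar X₀ k),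
      ← Matrix.mulVec_mulVec _ _ (traj A γbar X₀ k)]
    exact fun i => dotProduct_le_dotProduct_of_nonneg_left ih (Dmat_mul_nonneg hA hγ _ i)

theorem exists_pos_forall_mul_le {ι : Type*} [Finite ι] (f g : ι → ℝ) (hg : ∀ i, 0 < g i) :
    ∃ c : ℝ, 0 < c ∧ ∀ i, c * f i ≤ g i := by
  have h : ∀ᶠ c in 𝓝[>] (0 : ℝ), ∀ i, c * f i < g i := by
    refine Filter.eventually_all.2 fun i => ?_
    have hc : Tendsto (fun c : ℝ => c * f i) (𝓝[>] 0) (𝓝 (0 * f i)) :=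
      ((continuous_id.mul continuous_const).tendsto 0).mono_left nhdsWithin_le_nhds
    exact hc.eventually_lt_const (by simpa using hg i)
  obtain ⟨c, hc, hpos⟩ := (h.and self_mem_nhdsWithin).exists
  exact ⟨c, hpos, fun i => (hc i).le⟩

theorem stmt12 {n d : ℕ} (hn : 1 ≤ n) (hd : 1 ≤ d)
    (A : Matrix (Fin n) (Fin n) ℝ) (γbar : Fin n → (Fin d → ℝ) → ℝ)
    (hA : Assumption2 A γbar)
    (X₀ : Matrix (Fin n) (Fin d) ℝ) (hX₀ : X₀ ∈ Sset n d γbar)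
    (v : Fin n → ℝ) (hv : IsLimitVec A γbar X₀ v)
    (hcons : ConsensusDir (traj A γbar X₀)) :
    Matrix.vecMul v X₀ ≠ (0 : Fin d → ℝ) := by
  obtain ⟨hγ, ⟨E, hEpos, hEzero, -⟩, -⟩ := hA
  obtain ⟨-, hvpos, hlim⟩ := hv
  have hA0 : ∀ i j, 0 ≤ A i j := fun i j => by
    by_cases h : E i j
    · exact (hEpos i j h).le
    · exact (hEzero i j h).ge
  let i₀ : Fin n := ⟨0, hn⟩
  have hne : ∀ᶠ k in atTop, ∀ i, Atilde A γbar X₀ k i ≠ 0 := by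
    refine Filter.eventually_all.2 fun i => ?_
    have hv0 : v ≠ 0 := fun h => (hvpos i₀).ne' (congrFun h i₀)
    filter_upwards [(hlim i).eventually_ne hv0] with k hk h0
    exact hk (by rw [h0, smul_zero])
  have hclose : ∀ᶠ k in atTop, ∀ i, euclNorm ((euclNorm (traj A γbar X₀ k i))⁻¹ •
      traj A γbar X₀ k i - (euclNorm (traj A γbar X₀ k i₀))⁻¹ • traj A γbar X₀ k i₀) < 1 :=
    Filter.eventually_all.2 fun i => (hcons i i₀).eventually_lt_const one_pos
  obtain ⟨T, hTne, hTclose⟩ :=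
    ((tendsto_add_atTop_nat 1).eventually (hne.and hclose)).exists
  let u : Fin d → ℝ :=
    (euclNorm (traj A γbar X₀ (T + 1) i₀))⁻¹ • traj A γbar X₀ (T + 1) i₀
  have hu : ∀ i, 0 < (traj A γbar X₀ (T + 1) *ᵥ u) i := fun i =>
    dotProduct_normalize_pos (traj_succ_row_ne_zero (hTne i))
      (traj_succ_row_ne_zero (hTne i₀)) (hTclose i)
  obtain ⟨c, hc, hcT⟩ :=
    exists_pos_forall_mul_le (Atilde A γbar X₀ (T + 1) *ᵥ 1) _ hu
  have hT : Atilde A γbar X₀ (T + 1) *ᵥ (c • 1) ≤ traj A γbar X₀ (T + 1) *ᵥ u := fun i => by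
    rw [Matrix.mulVec_smul]
    exact hcT i
  have hle : v ⬝ᵥ (c • 1) ≤ v ⬝ᵥ (X₀ *ᵥ u) := by
    have htend : ∀ w : Fin n → ℝ, Tendsto
        (fun k => ((euclNorm (Atilde A γbar X₀ k i₀))⁻¹ • Atilde A γbar X₀ k i₀) ⬝ᵥ w)
        atTop (𝓝 (v ⬝ᵥ w)) := fun w =>
      ((continuous_id.dotProduct continuous_const).tendsto v).comp (hlim i₀)
    refine le_of_tendsto_of_tendsto (htend _) (htend _) ?_
    filter_upwards [eventually_ge_atTop (T + 1)] with k hk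
    have h := le_traj_mulVec_of_le hA0 hγ hT hk i₀
    rw [traj_eq_Atilde_mul, ← Matrix.mulVec_mulVec] at h
    rw [smul_dotProduct, smul_dotProduct]
    exact mul_le_mul_of_nonneg_left h (inv_nonneg.2 (euclNorm_nonneg _))
  have hpos : 0 < v ⬝ᵥ (c • 1) := by
    rw [dotProduct_smul, dotProduct_one]
    exact mul_pos hc (Finset.sum_pos (fun i _ => hvpos i) ⟨i₀, Finset.mem_univ _⟩)
  intro h0
  rw [Matrix.dotProduct_mulVec, h0, zero_dotProduct] at hle
  exact absurd hpos hle.not_gt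
end
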